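/- Let n ≥ 1 and m ≥ 1 be integers. For every real number μ ≥ m there exist s > 0, ε₀ > 0 and a bounded measurable weight ρ₁ : B_s → ℝ with ρ₁(x) ≥ ε₀ for all x ∈ B_s := {x ∈ ℝⁿ : |x| < s}, such that μ is a principal eigenvalue of the Navier eigenvalue problem (−Δ)^m v = μ ρ₁(x) v on B_s and, moreover, every principal eigenvalue of this problem is equal to μ. -/

import Mathlib

open MeasureTheory Metric Finset
open scoped ENNReal NNReal

noncomputable section

/-- Euclidean space `ℝⁿ`. -/
abbrev Esp (n : ℕ) := EuclideanSpace ℝ (Fin n)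

/-- First partial derivative `∂u/∂x_l`. -/
noncomputable def pderiv1 {n : ℕ} (u : Esp n → ℝ) (l : Fin n) (x : Esp n) : ℝ :=
  fderiv ℝ u x (EuclideanSpace.single l 1)

/-- Second partial derivative `∂²u/∂x_κ∂x_l`. -/
noncomputable def pderiv2 {n : ℕ} (u : Esp n → ℝ) (κ l : Fin n) (x : Esp n) : ℝ :=
  fderiv ℝ (fun y => fderiv ℝ u y (EuclideanSpace.single l 1)) x (EuclideanSpace.single κ 1)

/-- The nondivergence form operator `L u = Σ a_{κl} ∂_{κl} u + Σ b_l ∂_l u + c u`. -/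
noncomputable def Lop {n : ℕ} (a : Esp n → Fin n → Fin n → ℝ) (b : Esp n → Fin n → ℝ)
    (c : Esp n → ℝ) (u : Esp n → ℝ) (x : Esp n) : ℝ :=
  (∑ κ, ∑ l, a x κ l * pderiv2 u κ l x) + (∑ l, b x l * pderiv1 u l x) + c x * u x

/-- `u` is twice continuously differentiable in `Ω` with bounded second derivatives and
continuously differentiable on the closure of `Ω`. -/
def Regular {n : ℕ} (Ω : Set (Esp n)) (u : Esp n → ℝ) : Prop :=
  ContDiffOn ℝ 2 u Ω ∧ ContDiffOn ℝ 1 u (closure Ω) ∧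
    ∃ K : ℝ, ∀ x ∈ Ω, ∀ κ l : Fin n, |pderiv2 u κ l x| ≤ K

/-- The bounds on the coefficients of the operators: uniform ellipticity with constants
`c₀ ≤ C₀` and bound `b₀` on the lower order coefficients. -/
def CoeffBounds {n : ℕ} (Ω : Set (Esp n)) (a : Esp n → Fin n → Fin n → ℝ)
    (b : Esp n → Fin n → ℝ) (c : Esp n → ℝ) (c₀ C₀ b₀ : ℝ) : Prop :=
  (∀ x ∈ Ω, ∀ ξ : Fin n → ℝ,
      c₀ * ∑ l, ξ l ^ 2 ≤ ∑ κ, ∑ l, a x κ l * ξ κ * ξ l ∧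
      ∑ κ, ∑ l, a x κ l * ξ κ * ξ l ≤ C₀ * ∑ l, ξ l ^ 2) ∧
  (∀ x ∈ Ω, Real.sqrt (∑ l, b x l ^ 2) ≤ b₀) ∧ (∀ x ∈ Ω, |c x| ≤ b₀)

/-- `‖b‖_∞ = sup_{x ∈ Ω} (Σ_l b_l(x)²)^{1/2}`. -/
noncomputable def bSup {n : ℕ} (Ω : Set (Esp n)) (b : Esp n → Fin n → ℝ) : ℝ :=
  ⨆ x : Ω, Real.sqrt (∑ l, b (x : Esp n) l ^ 2)

/-- `inf_Ω c`. -/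
noncomputable def cInf {n : ℕ} (Ω : Set (Esp n)) (c : Esp n → ℝ) : ℝ :=
  ⨅ x : Ω, c (x : Esp n)

/-- The Lebesgue measure of a set, as a real number. -/
noncomputable def mvol {n : ℕ} (s : Set (Esp n)) : ℝ := (volume s).toReal

/-- The first Dirichlet eigenvalue `Σ = λ₁(-Δ, B₁)` of the unit ball, as the infimum of the
Rayleigh quotient over nonzero smooth compactly supported functions in `B₁`. -/
noncomputable def Sig (n : ℕ) : ℝ :=
  sInf { q : ℝ | ∃ u : Esp n → ℝ, ContDiff ℝ (⊤ : ℕ∞) u ∧ HasCompactSupport u ∧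
    tsupport u ⊆ ball (0 : Esp n) 1 ∧ u ≠ 0 ∧
    q = (∫ x in ball (0 : Esp n) 1, ‖fderiv ℝ u x‖ ^ 2) /
        (∫ x in ball (0 : Esp n) 1, u x ^ 2) }

/-- `L^p(Ω)` norm of a function. -/
noncomputable def LpNormOn {n : ℕ} (Ω : Set (Esp n)) (ρ : Esp n → ℝ) (p : ℝ≥0∞) : ℝ :=
  (eLpNorm ρ p (volume.restrict Ω)).toReal

/-- `Λ` is a principal eigenvalue of the generalized Lane–Emden system
`-L_i u_i = Λ_i ρ_i u_{i+1}^{α_i}` in `Ω`, `u = 0` on `∂Ω`. -/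
def IsPrincipalEV {n m : ℕ} [NeZero m] (Ω : Set (Esp n))
    (a : Fin m → Esp n → Fin n → Fin n → ℝ) (b : Fin m → Esp n → Fin n → ℝ)
    (c : Fin m → Esp n → ℝ) (ρ : Fin m → Esp n → ℝ) (α : Fin m → ℝ)
    (Λ : Fin m → ℝ) : Prop :=
  ∃ φ : Fin m → Esp n → ℝ,
    (∀ i, Regular Ω (φ i)) ∧
    (∀ i, ∀ x ∈ frontier Ω, φ i x = 0) ∧
    (∀ i, ∀ x ∈ Ω, 0 < φ i x) ∧
    ∀ i, ∀ᵐ x ∂(volume.restrict Ω),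
      -Lop (a i) (b i) (c i) (φ i) x = Λ i * ρ i x * φ (i + 1) x ^ α i

/-- `H(Λ) = λ₁ λ₂^{α₁} λ₃^{α₁α₂} ⋯ λ_m^{α₁⋯α_{m-1}}`. -/
noncomputable def Hfun {m : ℕ} (α Λ : Fin m → ℝ) : ℝ :=
  ∏ i, Λ i ^ (∏ j ∈ Finset.Iio i, α j)

/-- The Laplacian. -/
noncomputable def lapl {n : ℕ} (u : Esp n → ℝ) (x : Esp n) : ℝ := ∑ l, pderiv2 u l l x

/-- `lam` is a principal eigenvalue of the Navier problem `(-Δ)^m v = lam ρ v` in `Ω`,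
`v = (-Δ)^j v = 0` on `∂Ω`:  `v j` plays the role of `(-Δ)^j v`. -/
def IsNavierPrincipalEV {n : ℕ} (m : ℕ) [NeZero m] (Ω : Set (Esp n)) (ρ : Esp n → ℝ)
    (lam : ℝ) : Prop :=
  ∃ v : Fin m → Esp n → ℝ,
    (∀ j, Regular Ω (v j)) ∧
    (∀ j, ∀ x ∈ frontier Ω, v j x = 0) ∧
    (∀ j, ∀ x ∈ Ω, 0 < v j x) ∧
    (∀ j : Fin m, (j : ℕ) + 1 < m → ∀ x ∈ Ω, -lapl (v j) x = v (j + 1) x) ∧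
    ∀ j : Fin m, (j : ℕ) + 1 = m →
      ∀ᵐ x ∂(volume.restrict Ω), -lapl (v j) x = lam * ρ x * v 0 x

section NavierBall

variable {n : ℕ}

theorem differentiableAt_fderiv_apply {u : Esp n → ℝ} {x : Esp n} (hu : ContDiffAt ℝ 2 u x)
    (e : Esp n) : DifferentiableAt ℝ (fun y => fderiv ℝ u y e) x :=
  ((hu.fderiv_right (m := 1) (by norm_num)).differentiableAt (by norm_num)).clm_apply
    (differentiableAt_const e)

theorem pderiv2_lincomb {u w : Esp n → ℝ} {x : Esp n} (hu : ContDiffAt ℝ 2 u x)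
    (hw : ContDiffAt ℝ 2 w x) (a b : ℝ) (κ l : Fin n) :
    pderiv2 (fun y => a * u y + b * w y) κ l x = a * pderiv2 u κ l x + b * pderiv2 w κ l x := by
  unfold pderiv2
  set e : Esp n := EuclideanSpace.single l 1
  have h : (fun y => fderiv ℝ (fun y => a * u y + b * w y) y e) =ᶠ[nhds x]
      fun y => a * fderiv ℝ u y e + b * fderiv ℝ w y e := by
    filter_upwards [hu.eventually (by simp), hw.eventually (by simp)] with y hy hy'
    have h1 := (hy.differentiableAt (by norm_num)).hasFDerivAt.const_mul a
    have h2 := (hy'.differentiableAt (by norm_num)).hasFDerivAt.const_mul b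
    rw [(h1.fun_add h2).fderiv]
    simp
  rw [h.fderiv_eq]
  have h1 := (differentiableAt_fderiv_apply hu e).hasFDerivAt.const_mul a
  have h2 := (differentiableAt_fderiv_apply hw e).hasFDerivAt.const_mul b
  rw [(h1.fun_add h2).fderiv]
  simp

theorem lapl_lincomb {u w : Esp n → ℝ} {x : Esp n} (hu : ContDiffAt ℝ 2 u x)
    (hw : ContDiffAt ℝ 2 w x) (a b : ℝ) :
    lapl (fun y => a * u y + b * w y) x = a * lapl u x + b * lapl w x := by
  simp only [lapl, pderiv2_lincomb hu hw, Finset.sum_add_distrib, Finset.mul_sum]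

theorem continuousOn_pderiv2 {Ω : Set (Esp n)} (hΩ : IsOpen Ω) {u : Esp n → ℝ}
    (hu : ContDiffOn ℝ 2 u Ω) (κ l : Fin n) : ContinuousOn (pderiv2 u κ l) Ω := by
  intro x hx
  have h := hu.contDiffAt (hΩ.mem_nhds hx)
  have h1 : ContDiffAt ℝ 1 (fun y => fderiv ℝ u y (EuclideanSpace.single l 1)) x :=
    (h.fderiv_right (m := 1) (by norm_num)).clm_apply contDiffAt_const
  exact ((h1.fderiv_right (m := 0) (by norm_num)).continuousAt.clm_apply
    continuousAt_const).continuousWithinAt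

theorem continuousOn_lapl {Ω : Set (Esp n)} (hΩ : IsOpen Ω) {u : Esp n → ℝ}
    (hu : ContDiffOn ℝ 2 u Ω) : ContinuousOn (lapl u) Ω :=
  continuousOn_finsetSum _ fun l _ => continuousOn_pderiv2 hΩ hu l l

/-- The radial function `x ↦ P(|x|²)`. -/
def radial (n : ℕ) (P : Polynomial ℝ) (x : Esp n) : ℝ := P.eval (‖x‖ ^ 2)

theorem contDiff_radial (P : Polynomial ℝ) : ContDiff ℝ 2 (radial n P) := by
  have := (P.contDiff_aeval (𝕜 := ℝ) 2).comp (contDiff_norm_sq ℝ (E := Esp n))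
  simpa [Function.comp_def, radial, Polynomial.coe_aeval_eq_eval] using! this

theorem hasFDerivAt_radial (P : Polynomial ℝ) (x : Esp n) :
    HasFDerivAt (radial n P)
      (P.derivative.eval (‖x‖ ^ 2) • ((2 : ℝ) • innerSL ℝ x)) x := by
  have h : HasFDerivAt (fun x : Esp n => ‖x‖ ^ 2) ((2 : ℝ) • innerSL ℝ x) x := by
    simpa only [ofNat_smul_eq_nsmul] using (hasStrictFDerivAt_norm_sq x).hasFDerivAt
  exact (P.hasDerivAt (‖x‖ ^ 2)).comp_hasFDerivAt x h

theorem fderiv_radial_single (P : Polynomial ℝ) (x : Esp n) (l : Fin n) :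
    fderiv ℝ (radial n P) x (EuclideanSpace.single l 1) =
      radial n P.derivative x * (2 * x l) := by
  rw [(hasFDerivAt_radial P x).fderiv]
  simp [radial, EuclideanSpace.inner_single_right]

theorem lapl_radial (P : Polynomial ℝ) (x : Esp n) :
    lapl (radial n P) x = 4 * ‖x‖ ^ 2 * P.derivative.derivative.eval (‖x‖ ^ 2) +
      2 * n * P.derivative.eval (‖x‖ ^ 2) := by
  have h (l : Fin n) : pderiv2 (radial n P) l l x =
      4 * P.derivative.derivative.eval (‖x‖ ^ 2) * x l ^ 2 +
        2 * P.derivative.eval (‖x‖ ^ 2) := by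
    unfold pderiv2
    simp only [fderiv_radial_single]
    have h1 : HasFDerivAt (fun y : Esp n => 2 * y l)
        ((2 : ℝ) • (EuclideanSpace.proj l : Esp n →L[ℝ] ℝ)) x :=
      (EuclideanSpace.proj l : Esp n →L[ℝ] ℝ).hasFDerivAt.const_mul 2
    rw [((hasFDerivAt_radial P.derivative x).fun_mul h1).fderiv]
    simp [radial, EuclideanSpace.inner_single_right]
    ring
  simp only [lapl, h, Finset.sum_add_distrib, ← Finset.mul_sum, ← EuclideanSpace.real_norm_sq_eq]
  simp
  ring

theorem pderiv2_nonneg_of_isLocalMin {u : Esp n → ℝ} {x : Esp n} (hu : ContDiffAt ℝ 2 u x)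
    (hmin : IsLocalMin u x) (l : Fin n) : 0 ≤ pderiv2 u l l x := by
  by_contra! hneg
  set e : Esp n := EuclideanSpace.single l 1 with he
  have hline (t : ℝ) : HasDerivAt (fun t : ℝ => x + t • e) e t := by
    simpa using ((hasDerivAt_id t).smul_const e).const_add x
  have hx0 : x + (0 : ℝ) • e = x := by simp
  have htend : Filter.Tendsto (fun t : ℝ => x + t • e) (nhds 0) (nhds x) := by
    have := (hline 0).continuousAt.tendsto
    rwa [hx0] at this
  set g : ℝ → ℝ := fun t => u (x + t • e) with hg
  have hd : deriv g =ᶠ[nhds 0] fun t => fderiv ℝ u (x + t • e) e := by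
    filter_upwards [htend.eventually (hu.eventually (by simp))] with t ht
    exact ((ht.differentiableAt (by norm_num)).hasFDerivAt.comp_hasDerivAt t (hline t)).deriv
  have hd0 : deriv g 0 = 0 := by
    rw [hd.eq_of_nhds]
    simp [hmin.fderiv_eq_zero]
  have hdd : deriv (deriv g) 0 = pderiv2 u l l x := by
    rw [hd.deriv_eq]
    have h := (differentiableAt_fderiv_apply hu e).hasFDerivAt
    rw [← hx0] at h
    have := (h.comp_hasDerivAt (0 : ℝ) (hline 0)).deriv
    rw [hx0] at this
    exact this
  have hgc : ContinuousAt g 0 := by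
    have : ContinuousAt u (x + (0 : ℝ) • e) := by rw [hx0]; exact hu.continuousAt
    exact ContinuousAt.comp (f := fun t : ℝ => x + t • e) this (hline 0).continuousAt
  have hmax := isLocalMax_of_deriv_deriv_neg (by rw [hdd]; exact hneg) hd0 hgc
  have hconst : g =ᶠ[nhds 0] fun _ => g 0 := by
    filter_upwards [hmax, htend.eventually hmin] with t ht ht'
    exact le_antisymm ht (by simpa [hg] using ht')
  have : deriv (deriv g) 0 = 0 := by
    rw [hconst.deriv.deriv_eq]
    simp
  linarith

/-- Weak minimum principle on the unit ball. -/
theorem nonneg_of_lapl_nonpos (hn : 1 ≤ n) {u : Esp n → ℝ}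
    (hc : ContinuousOn u (closedBall 0 1)) (hu : ContDiffOn ℝ 2 u (ball 0 1))
    (hbd : ∀ x ∈ sphere (0 : Esp n) 1, 0 ≤ u x)
    (hin : ∀ x ∈ ball (0 : Esp n) 1, u x < 0 → lapl u x ≤ 0) :
    ∀ x ∈ closedBall (0 : Esp n) 1, 0 ≤ u x := by
  intro x₀ hx₀
  by_contra! hneg
  set ε : ℝ := -u x₀ / 2 with hε
  have hε0 : 0 < ε := by linarith
  set p : Esp n → ℝ := radial n (1 - Polynomial.X) with hp
  have hpe (x : Esp n) : p x = 1 - ‖x‖ ^ 2 := by simp [hp, radial]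
  obtain ⟨y, hy, hmin⟩ := (isCompact_closedBall (0 : Esp n) 1).exists_isMinOn ⟨x₀, hx₀⟩
    ((hc.const_mul 1).add ((contDiff_radial (n := n)
      (1 - Polynomial.X)).continuous.continuousOn.const_mul ε))
  have hp0 : 0 ≤ p y := by
    have : ‖y‖ ≤ 1 := by simpa using hy
    rw [hpe]; nlinarith [norm_nonneg y]
  have hpx : p x₀ ≤ 1 := by rw [hpe]; nlinarith [sq_nonneg ‖x₀‖]
  have hyx : 1 * u y + ε * p y ≤ 1 * u x₀ + ε * p x₀ := hmin hx₀
  have huy : u y < 0 := by nlinarith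
  have hyb : y ∈ ball (0 : Esp n) 1 := by
    by_contra hyb
    have : ‖y‖ = 1 := le_antisymm (by simpa using hy) (by simpa using hyb)
    linarith [hbd y (by simpa using this)]
  have huC := hu.contDiffAt (isOpen_ball.mem_nhds hyb)
  have hpC : ContDiffAt ℝ 2 p y := (contDiff_radial _).contDiffAt
  have hloc : IsLocalMin (fun x => 1 * u x + ε * p x) y :=
    hmin.isLocalMin (Filter.mem_of_superset (isOpen_ball.mem_nhds hyb) ball_subset_closedBall)
  have hnn : 0 ≤ lapl (fun x => 1 * u x + ε * p x) y :=
    Finset.sum_nonneg fun l _ => pderiv2_nonneg_of_isLocalMin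
      ((contDiffAt_const.mul huC).add (contDiffAt_const.mul hpC)) hloc l
  have hlp : lapl p y = -(2 * n) := by rw [hp, lapl_radial]; simp
  rw [lapl_lincomb huC hpC, hlp] at hnn
  have hn' : (1 : ℝ) ≤ n := by exact_mod_cast hn
  nlinarith [hin y hyb huy, mul_pos hε0 (lt_of_lt_of_le one_pos hn')]

/-- Comparison principle on the unit ball. -/
theorem le_of_neg_lapl_le (hn : 1 ≤ n) {u w : Esp n → ℝ}
    (huc : ContinuousOn u (closedBall 0 1)) (hu : ContDiffOn ℝ 2 u (ball 0 1))
    (hwc : ContinuousOn w (closedBall 0 1)) (hw : ContDiffOn ℝ 2 w (ball 0 1))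
    (hbd : ∀ x ∈ sphere (0 : Esp n) 1, u x ≤ w x)
    (hin : ∀ x ∈ ball (0 : Esp n) 1, w x < u x → -lapl u x ≤ -lapl w x) :
    ∀ x ∈ closedBall (0 : Esp n) 1, u x ≤ w x := by
  intro x hx
  have := nonneg_of_lapl_nonpos hn (u := fun x => 1 * w x + (-1) * u x)
    ((hwc.const_mul 1).add (huc.const_mul (-1)))
    ((contDiffOn_const.mul hw).add (contDiffOn_const.mul hu))
    (fun x hx => by linarith [hbd x hx])
    (fun x hx h => by
      rw [lapl_lincomb (hw.contDiffAt (isOpen_ball.mem_nhds hx))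
        (hu.contDiffAt (isOpen_ball.mem_nhds hx))]
      linarith [hin x hx (by linarith)]) x hx
  linarith

theorem lapl_const_mul {u : Esp n → ℝ} {x : Esp n} (hu : ContDiffAt ℝ 2 u x) (a : ℝ) :
    lapl (fun y => a * u y) x = a * lapl u x := by
  simpa using lapl_lincomb hu hu a 0

/-- A positive function vanishing on the sphere, with bounded Laplacian, is bounded by a multiple
of `1 - |x|²`. -/
theorem exists_le_mul_one_sub_norm_sq (hn : 1 ≤ n) {u : Esp n → ℝ}
    (huc : ContinuousOn u (closedBall 0 1)) (hu : ContDiffOn ℝ 2 u (ball 0 1))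
    (hbd : ∀ x ∈ sphere (0 : Esp n) 1, u x = 0)
    (hK : ∃ K : ℝ, ∀ x ∈ ball (0 : Esp n) 1, ∀ κ l : Fin n, |pderiv2 u κ l x| ≤ K) :
    ∃ C : ℝ, ∀ x ∈ ball (0 : Esp n) 1, u x ≤ C * (1 - ‖x‖ ^ 2) := by
  obtain ⟨K, hK⟩ := hK
  refine ⟨K / 2, fun x hx => ?_⟩
  have hP : ContDiff ℝ 2 (fun x : Esp n => K / 2 * radial n (1 - Polynomial.X) x) :=
    contDiff_const.mul (contDiff_radial _)
  have := le_of_neg_lapl_le hn huc hu hP.continuous.continuousOn hP.contDiffOn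
    (fun x hx => by
      rw [hbd x hx]
      have : ‖x‖ = 1 := by simpa using hx
      simp [radial, this])
    (fun x hx _ => by
      rw [lapl_const_mul (contDiff_radial _).contDiffAt, lapl_radial]
      have : -lapl u x ≤ ∑ _l : Fin n, K := by
        rw [lapl, ← Finset.sum_neg_distrib]
        exact Finset.sum_le_sum fun l _ => (neg_le_abs _).trans (hK x hx l l)
      simp at this ⊢
      linarith) x (ball_subset_closedBall hx)
  simpa [radial] using this

/-- Hopf-type lower bound for positive superharmonic functions on the unit ball. -/
theorem exists_mul_one_sub_norm_sq_le (hn : 1 ≤ n) {u : Esp n → ℝ}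
    (huc : ContinuousOn u (closedBall 0 1)) (hu : ContDiffOn ℝ 2 u (ball 0 1))
    (hbd : ∀ x ∈ sphere (0 : Esp n) 1, u x = 0) (hpos : ∀ x ∈ ball (0 : Esp n) 1, 0 < u x)
    (hsup : ∀ x ∈ ball (0 : Esp n) 1, 0 ≤ -lapl u x) :
    ∃ c : ℝ, 0 < c ∧ ∀ x ∈ ball (0 : Esp n) 1, c * (1 - ‖x‖ ^ 2) ≤ u x := by
  have hn' : (1 : ℝ) ≤ n := by exact_mod_cast hn
  set δ : ℝ := 1 / (4 * n) with hδ
  have hnδ : n * δ = 1 / 4 := by rw [hδ]; field_simp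
  have hδ0 : 0 < δ := by positivity
  have hδ1 : δ ≤ 1 / 4 := by nlinarith
  have hsq : √(1 - δ) < 1 := by rw [Real.sqrt_lt' one_pos]; linarith
  obtain ⟨y, hy, hmin⟩ := (isCompact_closedBall (0 : Esp n) (√(1 - δ))).exists_isMinOn
    ⟨0, by simp⟩ (huc.mono (closedBall_subset_closedBall hsq.le))
  have hy0 : 0 < u y := hpos y (closedBall_subset_ball hsq hy)
  set c : ℝ := u y / (1 + n) with hc
  have hc0 : 0 < c := by positivity
  set P : Polynomial ℝ := (1 - Polynomial.X) + Polynomial.C (n : ℝ) * (1 - Polynomial.X) ^ 2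
  have hPe (x : Esp n) : radial n P x = (1 - ‖x‖ ^ 2) + n * (1 - ‖x‖ ^ 2) ^ 2 := by
    simp [radial, P]
  have hP : ContDiff ℝ 2 (fun x : Esp n => c * radial n P x) :=
    contDiff_const.mul (contDiff_radial _)
  have hle := le_of_neg_lapl_le hn hP.continuous.continuousOn hP.contDiffOn huc hu
    (fun x hx => by
      rw [hbd x hx]
      have : ‖x‖ = 1 := by simpa using hx
      simp [hPe, this])
    (fun x hx hlt => by
      refine le_trans ?_ (hsup x hx)
      have hx1 : ‖x‖ < 1 := by simpa using hx
      have hx2 : ‖x‖ ^ 2 < 1 := by nlinarith [norm_nonneg x]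
      have hxδ : 1 - δ < ‖x‖ ^ 2 := by
        by_contra! h
        have h1 : u y ≤ u x := hmin (by
          simpa using Real.le_sqrt_of_sq_le h)
        have h2 : radial n P x ≤ 1 + n := by
          rw [hPe]
          have : (1 - ‖x‖ ^ 2) ^ 2 ≤ 1 := by nlinarith [sq_nonneg ‖x‖]
          nlinarith [sq_nonneg ‖x‖]
        have h3 : c * (1 + n) = u y := by rw [hc]; field_simp
        nlinarith
      rw [lapl_const_mul (contDiff_radial _).contDiffAt, lapl_radial]
      have h1 : P.derivative.eval (‖x‖ ^ 2) = -1 - 2 * n * (1 - ‖x‖ ^ 2) := by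
        simp [P, Polynomial.derivative_pow]; ring
      have h2 : P.derivative.derivative.eval (‖x‖ ^ 2) = 2 * n := by
        simp [P, Polynomial.derivative_pow, mul_comm]
      rw [h1, h2]
      have h3 : n * (1 - ‖x‖ ^ 2) ≤ 1 / 4 := by nlinarith
      have h4 : 0 ≤ n * (4 * ‖x‖ ^ 2 - 1 - 2 * (n * (1 - ‖x‖ ^ 2))) :=
        mul_nonneg (by linarith) (by nlinarith)
      nlinarith [mul_nonneg hc0.le h4])
  refine ⟨c, hc0, fun x hx => le_trans ?_ (hle x (ball_subset_closedBall hx))⟩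
  rw [hPe]
  exact mul_le_mul_of_nonneg_left (le_add_of_nonneg_right (by positivity)) hc0.le

/-- `v` is a tuple of principal eigenfunctions on the unit ball, with the last equation holding
everywhere. -/
structure NavierTuple (m : ℕ) [NeZero m] (ρ : Esp n → ℝ) (lam : ℝ)
    (v : Fin m → Esp n → ℝ) : Prop where
  cont : ∀ j, ContinuousOn (v j) (closedBall 0 1)
  smooth : ∀ j, ContDiffOn ℝ 2 (v j) (ball 0 1)
  bounded : ∀ j, ∃ K : ℝ, ∀ x ∈ ball (0 : Esp n) 1, ∀ κ l : Fin n, |pderiv2 (v j) κ l x| ≤ K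
  boundary : ∀ j, ∀ x ∈ sphere (0 : Esp n) 1, v j x = 0
  pos : ∀ j, ∀ x ∈ ball (0 : Esp n) 1, 0 < v j x
  step : ∀ j : Fin m, (j : ℕ) + 1 < m → ∀ x ∈ ball (0 : Esp n) 1, -lapl (v j) x = v (j + 1) x
  last : ∀ j : Fin m, (j : ℕ) + 1 = m → ∀ x ∈ ball (0 : Esp n) 1,
    -lapl (v j) x = lam * ρ x * v 0 x

theorem IsNavierPrincipalEV.exists_navierTuple {m : ℕ} [NeZero m] {ρ : Esp n → ℝ} {lam : ℝ}
    (hρ : ContinuousOn ρ (ball 0 1)) (h : IsNavierPrincipalEV m (ball (0 : Esp n) 1) ρ lam) :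
    ∃ v : Fin m → Esp n → ℝ, NavierTuple m ρ lam v := by
  obtain ⟨v, hreg, hbd, hpos, hstep, hlast⟩ := h
  rw [frontier_ball _ one_ne_zero] at hbd
  refine ⟨v, ⟨fun j => ?_, fun j => (hreg j).1, fun j => (hreg j).2.2, hbd, hpos, hstep,
    fun j hj => ?_⟩⟩
  · rw [← closure_ball _ one_ne_zero]
    exact (hreg j).2.1.continuousOn
  · exact Measure.eqOn_open_of_ae_eq (hlast j hj) isOpen_ball
      (continuousOn_lapl isOpen_ball (hreg j).1).neg
      ((continuousOn_const.mul hρ).mul (hreg 0).1.continuousOn)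

namespace NavierTuple

variable {m : ℕ} [NeZero m] {ρ : Esp n → ℝ} {lam μ : ℝ} {v w : Fin m → Esp n → ℝ}

theorem eigenvalue_pos (hn : 1 ≤ n) (hv : NavierTuple m ρ lam v)
    (hρ : ∀ x ∈ ball (0 : Esp n) 1, 0 < ρ x) : 0 < lam := by
  by_contra! hlam
  have hm : 0 < m := NeZero.pos m
  set j : Fin m := ⟨m - 1, by omega⟩
  have h := le_of_neg_lapl_le hn (hv.cont j) (hv.smooth j)
    (contDiff_radial (n := n) 0).continuous.continuousOn (contDiff_radial 0).contDiffOn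
    (fun x hx => by simp [hv.boundary j x hx, radial])
    (fun x hx _ => by
      rw [hv.last j (by simp [j]; omega) x hx, lapl_radial, mul_assoc]
      simpa using mul_nonpos_of_nonpos_of_nonneg hlam
        (mul_pos (hρ x hx) (hv.pos 0 x hx)).le) 0 (by simp)
  have := hv.pos j 0 (by simp)
  simp [radial] at h
  linarith

theorem neg_lapl_nonneg (hv : NavierTuple m ρ lam v) (hρ : ∀ x ∈ ball (0 : Esp n) 1, 0 < ρ x)
    (hlam : 0 < lam) (j : Fin m) {x : Esp n} (hx : x ∈ ball (0 : Esp n) 1) :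
    0 ≤ -lapl (v j) x := by
  rcases lt_or_eq_of_le (Nat.succ_le_of_lt j.2) with h | h
  · rw [hv.step j h x hx]
    exact (hv.pos _ x hx).le
  · rw [hv.last j h x hx]
    exact (mul_pos (mul_pos hlam (hρ x hx)) (hv.pos 0 x hx)).le

theorem le_mul_div (hn : 1 ≤ n) (hv : NavierTuple m ρ lam v) (hw : NavierTuple m ρ μ w)
    (hρ : ∀ x ∈ ball (0 : Esp n) 1, 0 < ρ x) (hlam : 0 < lam) (hμ : 0 < μ) {M : ℝ}
    (hM : ∀ x ∈ ball (0 : Esp n) 1, v 0 x ≤ M * w 0 x) :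
    ∀ x ∈ ball (0 : Esp n) 1, v 0 x ≤ lam / μ * M * w 0 x := by
  have hcomp (j : Fin m) (h : ∀ x ∈ ball (0 : Esp n) 1,
      -lapl (v j) x ≤ lam / μ * M * -lapl (w j) x) :
      ∀ x ∈ ball (0 : Esp n) 1, v j x ≤ lam / μ * M * w j x := fun x hx =>
    le_of_neg_lapl_le hn (hv.cont j) (hv.smooth j) ((hw.cont j).const_mul (lam / μ * M))
      (contDiffOn_const.mul (hw.smooth j))
      (fun x hx => by rw [hv.boundary j x hx, hw.boundary j x hx]; simp)
      (fun x hx _ => by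
        rw [lapl_const_mul ((hw.smooth j).contDiffAt (isOpen_ball.mem_nhds hx))]
        linarith [h x hx]) x (ball_subset_closedBall hx)
  have key (k : ℕ) : ∀ j : Fin m, (j : ℕ) + k + 1 = m →
      ∀ x ∈ ball (0 : Esp n) 1, v j x ≤ lam / μ * M * w j x := by
    induction k with
    | zero =>
      intro j hj
      refine hcomp j fun x hx => ?_
      rw [hv.last j hj x hx, hw.last j hj x hx]
      have h1 := mul_le_mul_of_nonneg_left (hM x hx) (mul_pos hlam (hρ x hx)).le
      have h2 : lam / μ * M * (μ * ρ x * w 0 x) = lam * ρ x * (M * w 0 x) := by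
        field_simp
      linarith
    | succ k ih =>
      intro j hj
      refine hcomp j fun x hx => ?_
      rw [hv.step j (by omega) x hx, hw.step j (by omega) x hx]
      refine ih (j + 1) ?_ x hx
      rw [Fin.val_add_one_of_lt' (by omega)]
      omega
  exact key (m - 1) 0 (by simp; have := NeZero.pos m; omega)

theorem eigenvalue_le (hn : 1 ≤ n) (hv : NavierTuple m ρ lam v) (hw : NavierTuple m ρ μ w)
    (hρ : ∀ x ∈ ball (0 : Esp n) 1, 0 < ρ x) : μ ≤ lam := by
  have hlam := hv.eigenvalue_pos hn hρ
  have hμ := hw.eigenvalue_pos hn hρ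
  obtain ⟨C, hC⟩ := exists_le_mul_one_sub_norm_sq hn (hv.cont 0) (hv.smooth 0) (hv.boundary 0)
    (hv.bounded 0)
  obtain ⟨c, hc, hcw⟩ := exists_mul_one_sub_norm_sq_le hn (hw.cont 0) (hw.smooth 0)
    (hw.boundary 0) (hw.pos 0) fun x hx => hw.neg_lapl_nonneg hρ hμ 0 hx
  have h0 : (0 : Esp n) ∈ ball (0 : Esp n) 1 := by simp
  have hC0 : 0 < C := by
    have h1 := hC 0 h0
    have h2 := hv.pos 0 0 h0
    simp at h1
    linarith
  have hM : ∀ x ∈ ball (0 : Esp n) 1, v 0 x ≤ C / c * w 0 x := fun x hx => by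
    refine (hC x hx).trans ?_
    have := mul_le_mul_of_nonneg_left (hcw x hx) (div_pos hC0 hc).le
    rwa [← mul_assoc, div_mul_cancel₀ _ hc.ne'] at this
  have hiter (k : ℕ) : ∀ x ∈ ball (0 : Esp n) 1,
      v 0 x ≤ (lam / μ) ^ k * (C / c) * w 0 x := by
    induction k with
    | zero => simpa using hM
    | succ k ih =>
      intro x hx
      have := le_mul_div hn hv hw hρ hlam hμ ih x hx
      rwa [← mul_assoc, ← pow_succ'] at this
  by_contra! hlt
  have ht := ((tendsto_pow_atTop_nhds_zero_of_lt_one (div_pos hlam hμ).le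
    ((div_lt_one hμ).2 hlt)).mul_const (C / c)).mul_const (w 0 0)
  have := ge_of_tendsto' ht fun k => hiter k 0 h0
  linarith [hv.pos 0 0 h0]

end NavierTuple

theorem exists_polynomial_radial_laplacian_eq (hn : 1 ≤ n) (g : Polynomial ℝ) :
    ∃ f : Polynomial ℝ, ∀ t : ℝ,
      4 * t * f.derivative.derivative.eval t + 2 * n * f.derivative.eval t = g.eval t := by
  induction g using Polynomial.induction_on' with
  | add p q hp hq =>
    obtain ⟨f, hf⟩ := hp
    obtain ⟨g, hg⟩ := hq
    refine ⟨f + g, fun t => ?_⟩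
    simp only [Polynomial.derivative_add, Polynomial.eval_add, ← hf, ← hg]
    ring
  | monomial k a =>
    have hn' : (1 : ℝ) ≤ n := by exact_mod_cast hn
    refine ⟨Polynomial.monomial (k + 1) (a / ((k + 1) * (4 * k + 2 * n))), fun t => ?_⟩
    rcases k with _ | k
    · simp
      field_simp
    · simp [pow_succ]
      field_simp

/-- The Dirichlet problem `-Δu = (1 - |x|²) q(|x|²)` on the unit ball has a solution
`(1 - |x|²) r(|x|²)` with `r` a polynomial that is positive on `[0, 1]` if `q` is. -/
theorem exists_polynomial_dirichlet (hn : 1 ≤ n) (q : Polynomial ℝ)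
    (hq : ∀ t ∈ Set.Icc (0 : ℝ) 1, 0 < q.eval t) :
    ∃ r : Polynomial ℝ, (∀ t ∈ Set.Icc (0 : ℝ) 1, 0 < r.eval t) ∧
      ∀ x : Esp n, -lapl (radial n ((1 - Polynomial.X) * r)) x =
        radial n ((1 - Polynomial.X) * q) x := by
  obtain ⟨f₀, hf₀⟩ := exists_polynomial_radial_laplacian_eq hn (-((1 - Polynomial.X) * q))
  set f := f₀ - Polynomial.C (f₀.eval 1) with hf
  have hfd : f.derivative = f₀.derivative := by simp [hf]
  obtain ⟨s, hs⟩ := Polynomial.dvd_iff_isRoot.2 (show f.IsRoot 1 by simp [hf])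
  have hfr : f = (1 - Polynomial.X) * -s := by rw [hs, Polynomial.C_1]; ring
  have hflow : ∀ t ∈ Set.Ioc (0 : ℝ) 1, f.derivative.eval t < 0 := by
    set h : Polynomial ℝ := Polynomial.X ^ n * f.derivative.comp (Polynomial.X ^ 2) with hh
    have hanti : StrictAntiOn (fun u => h.eval u) (Set.Icc 0 1) := by
      refine strictAntiOn_of_deriv_neg (convex_Icc 0 1) h.continuous.continuousOn fun u hu => ?_
      rw [interior_Icc] at hu
      have hu0 : 0 < u := hu.1
      have hu2 : 0 < 1 - u ^ 2 := by nlinarith [hu.2]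
      rw [h.deriv]
      have h1 : u * h.derivative.eval u = -(u ^ n / 2 * ((1 - u ^ 2) * q.eval (u ^ 2))) := by
        have h2 := hf₀ (u ^ 2)
        rw [← hfd] at h2
        obtain ⟨k, rfl⟩ := Nat.exists_eq_add_of_le' hn
        simp [hh, Polynomial.derivative_comp] at h2 ⊢
        linear_combination u ^ (k + 1) / 2 * h2
      have h3 : 0 < u ^ n / 2 * ((1 - u ^ 2) * q.eval (u ^ 2)) :=
        mul_pos (by positivity) (mul_pos hu2 (hq _ ⟨by positivity, by linarith⟩))
      by_contra! h4
      nlinarith [mul_nonneg hu0.le h4]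
    intro t ht
    have hsq : 0 < √t := Real.sqrt_pos.2 ht.1
    have h1 := hanti (by simp) ⟨hsq.le, Real.sqrt_le_one.2 ht.2⟩ hsq
    have h0 : n ≠ 0 := by omega
    simp [hh, Real.sq_sqrt ht.1.le, h0] at h1
    by_contra! h2
    exact absurd h1 (not_lt.2 (mul_nonneg (by positivity) h2))
  have hfanti : StrictAntiOn (fun t => f.eval t) (Set.Icc 0 1) := by
    refine strictAntiOn_of_deriv_neg (convex_Icc 0 1) f.continuous.continuousOn fun u hu => ?_
    rw [interior_Icc] at hu
    rw [f.deriv]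
    exact hflow u ⟨hu.1, hu.2.le⟩
  refine ⟨-s, fun t ht => ?_, fun x => ?_⟩
  · rcases eq_or_lt_of_le ht.2 with rfl | h1
    · have := hflow 1 (by simp)
      rw [hs] at this
      simpa using this
    · have h2 := hfanti ht (by simp) h1
      rw [hfr] at h2
      simp at h2 ⊢
      nlinarith
  · rw [← hfr, lapl_radial, hfd, hf₀]
    simp [radial]

theorem exists_radial_sequence (hn : 1 ≤ n) : ∃ q : ℕ → Polynomial ℝ,
    (∀ k, ∀ t ∈ Set.Icc (0 : ℝ) 1, 0 < (q k).eval t) ∧ q 0 = 1 ∧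
      ∀ k, ∀ x : Esp n, -lapl (radial n ((1 - Polynomial.X) * q (k + 1))) x =
        radial n ((1 - Polynomial.X) * q k) x := by
  choose! r hr hr' using fun q => exists_polynomial_dirichlet (n := n) hn q
  have hpos (k : ℕ) : ∀ t ∈ Set.Icc (0 : ℝ) 1, 0 < (r^[k] 1).eval t := by
    induction k with
    | zero => simp
    | succ k ih =>
      rw [Function.iterate_succ_apply']
      exact hr _ ih
  refine ⟨fun k => r^[k] 1, hpos, rfl, fun k => ?_⟩
  simp only [Function.iterate_succ_apply']
  exact hr' _ (hpos k)

theorem regular_radial (P : Polynomial ℝ) : Regular (ball (0 : Esp n) 1) (radial n P) := by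
  have h := contDiff_radial (n := n) P
  refine ⟨h.contDiffOn, (h.of_le (by norm_num)).contDiffOn, ?_⟩
  have hc (p : Fin n × Fin n) : ∃ K, ∀ x ∈ closedBall (0 : Esp n) 1,
      ‖pderiv2 (radial n P) p.1 p.2 x‖ ≤ K :=
    (isCompact_closedBall (0 : Esp n) 1).exists_bound_of_continuousOn
      ((continuousOn_pderiv2 isOpen_univ h.contDiffOn p.1 p.2).mono (Set.subset_univ _))
  choose K hK using hc
  refine ⟨∑ p, |K p|, fun x hx κ l => ?_⟩
  exact ((hK (κ, l) x (ball_subset_closedBall hx)).trans (le_abs_self _)).trans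
    (Finset.single_le_sum (f := fun p => |K p|) (fun p _ => abs_nonneg _) (Finset.mem_univ (κ, l)))

end NavierBall

/-- remark after Theorem 1.7: every `μ ≥ m` is realized as the unique
principal eigenvalue of a Navier poly-Laplacian problem on a suitable ball with a
suitable weight. -/
theorem stmt19 {n : ℕ} (hn : 1 ≤ n) (m : ℕ) [NeZero m] (hm : 1 ≤ m)
    (μ : ℝ) (hμ : (m : ℝ) ≤ μ) :
    ∃ (s ε₀ : ℝ) (ρ : Esp n → ℝ), 0 < s ∧ 0 < ε₀ ∧ Measurable ρ ∧
      (∃ Kb : ℝ, ∀ x ∈ ball (0 : Esp n) s, |ρ x| ≤ Kb) ∧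
      (∀ x ∈ ball (0 : Esp n) s, ε₀ ≤ ρ x) ∧
      IsNavierPrincipalEV m (ball (0 : Esp n) s) ρ μ ∧
      ∀ lam : ℝ, IsNavierPrincipalEV m (ball (0 : Esp n) s) ρ lam → lam = μ := by
  have hμ0 : 0 < μ := lt_of_lt_of_le (by exact_mod_cast hm) hμ
  obtain ⟨q, hq, hq0, hlap⟩ := exists_radial_sequence hn
  have ht (x : Esp n) (hx : x ∈ ball (0 : Esp n) 1) : ‖x‖ ^ 2 ∈ Set.Icc (0 : ℝ) 1 := by
    have : ‖x‖ < 1 := by simpa using hx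
    exact ⟨by positivity, by nlinarith [norm_nonneg x]⟩
  have hqm (x : Esp n) (hx : x ∈ ball (0 : Esp n) 1) : 0 < radial n (q m) x := hq m _ (ht x hx)
  obtain ⟨a, ha, hamin⟩ := isCompact_Icc.exists_isMinOn (Set.nonempty_Icc.2 zero_le_one)
    (q m).continuous.continuousOn
  obtain ⟨b, hb, hbmax⟩ := isCompact_Icc.exists_isMaxOn (Set.nonempty_Icc.2 zero_le_one)
    (q m).continuous.continuousOn
  have ha0 := hq m a ha
  have hb0 := hq m b hb
  have hρpos : ∀ x ∈ ball (0 : Esp n) 1, 0 < (μ * radial n (q m) x)⁻¹ := fun x hx =>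
    inv_pos.2 (mul_pos hμ0 (hqm x hx))
  have hcont := (contDiff_radial (n := n) (q m)).continuous
  have hρcont : ContinuousOn (fun x : Esp n => (μ * radial n (q m) x)⁻¹) (ball 0 1) :=
    (continuous_const.mul hcont).continuousOn.inv₀ fun x hx => (mul_pos hμ0 (hqm x hx)).ne'
  have hEV : IsNavierPrincipalEV m (ball (0 : Esp n) 1)
      (fun x => (μ * radial n (q m) x)⁻¹) μ := by
    refine ⟨fun j => radial n ((1 - Polynomial.X) * q (m - j)), fun j => regular_radial _,
      fun j x hx => ?_, fun j x hx => ?_, fun j hj x _ => ?_, fun j hj => ?_⟩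
    · rw [frontier_ball _ one_ne_zero] at hx
      have : ‖x‖ = 1 := by simpa using hx
      simp [radial, this]
    · have h1 : ‖x‖ < 1 := by simpa using hx
      have h2 : 0 < 1 - ‖x‖ ^ 2 := by nlinarith [norm_nonneg x]
      simpa [radial] using mul_pos h2 (hq _ _ (ht x hx))
    · have h1 : m - (j : ℕ) = m - ((j + 1 : Fin m) : ℕ) + 1 := by
        rw [Fin.val_add_one_of_lt' hj]
        omega
      simp only [h1]
      exact hlap _ x
    · filter_upwards [ae_restrict_mem measurableSet_ball] with x hx
      have h1 : m - (j : ℕ) = 0 + 1 := by omega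
      simp only [h1, hlap, hq0]
      have := (hqm x hx).ne'
      simp only [radial, Polynomial.eval_mul, Fin.val_zero, Nat.sub_zero, Polynomial.eval_one] at *
      field_simp
  refine ⟨1, (μ * (q m).eval b)⁻¹, fun x => (μ * radial n (q m) x)⁻¹, one_pos, by positivity,
    (hcont.measurable.const_mul μ).inv, ⟨(μ * (q m).eval a)⁻¹, fun x hx => ?_⟩,
    fun x hx => ?_, hEV, fun lam hlam => ?_⟩
  · rw [abs_of_pos (hρpos x hx)]
    exact inv_anti₀ (by positivity) (mul_le_mul_of_nonneg_left (hamin (ht x hx)) hμ0.le)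
  · exact inv_anti₀ (mul_pos hμ0 (hqm x hx))
      (mul_le_mul_of_nonneg_left (hbmax (ht x hx)) hμ0.le)
  · obtain ⟨v, hv⟩ := hlam.exists_navierTuple hρcont
    obtain ⟨w, hw⟩ := hEV.exists_navierTuple hρcont
    exact le_antisymm (hw.eigenvalue_le hn hv hρpos) (hv.eigenvalue_le hn hw hρpos)

end
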